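/- If the set 𝒢(p) of probability measures compatible with the imitation kernel p has exactly one element, then the stochastic matrix P̂ = Σ_{k∈A} θ_k P_(k) has a unique invariant probability vector λ (λP̂ = λ). -/

import Mathlib

open MeasureTheory
open scoped BigOperators

/-- The matrix of a word `𝐚 = (a_1, …, a_n)` (encoded as a list `[a_1, …, a_n]`),
namely `P_𝐚 = P_(a_n) ⋯ P_(a_1)`, so that `wordK P l i j` is the `(i,j)` entry. -/
noncomputable def wordK {G : Type*} [Fintype G] [DecidableEq G]
    (P : ℕ → G → G → ℝ) : List ℕ → G → G → ℝ
  | [] => fun i j => if i = j then 1 else 0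
  | a :: l => fun i j => ∑ m, wordK P l i m * P a m j

/-- A word over the alphabet `A`: a nonempty finite tuple with entries in `A`. -/
def IsWord (A : Set ℕ) (l : List ℕ) : Prop := l ≠ [] ∧ ∀ a ∈ l, a ∈ A

/-- `i` communicates with `j` if `P_𝐚(i,j) > 0` for some word `𝐚`. -/
def Communicates {G : Type*} [Fintype G] [DecidableEq G]
    (A : Set ℕ) (P : ℕ → G → G → ℝ) (i j : G) : Prop :=
  ∃ l : List ℕ, IsWord A l ∧ 0 < wordK P l i j

/-- `i` and `j` intercommunicate (every state intercommunicates with itself). -/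
def Intercommunicates {G : Type*} [Fintype G] [DecidableEq G]
    (A : Set ℕ) (P : ℕ → G → G → ℝ) (i j : G) : Prop :=
  i = j ∨ (Communicates A P i j ∧ Communicates A P j i)

/-- An intercommunicating class: an equivalence class of the intercommunication relation. -/
def IsInterClass {G : Type*} [Fintype G] [DecidableEq G]
    (A : Set ℕ) (P : ℕ → G → G → ℝ) (C : Set G) : Prop :=
  ∃ i : G, C = {j | Intercommunicates A P i j}

/-- A set `C` is closed if whenever `i ∈ C` communicates with `j`, then `j ∈ C`. -/
def IsClosedClass {G : Type*} [Fintype G] [DecidableEq G]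
    (A : Set ℕ) (P : ℕ → G → G → ℝ) (C : Set G) : Prop :=
  ∀ i ∈ C, ∀ j : G, Communicates A P i j → j ∈ C

/-- `d` is the greatest common divisor of the set `S ⊆ ℕ`. -/
def IsGCDOfSet (S : Set ℕ) (d : ℕ) : Prop :=
  (∀ n ∈ S, d ∣ n) ∧ ∀ e : ℕ, (∀ n ∈ S, e ∣ n) → e ∣ d

/-- The set of depths `s(𝐚)` of words `𝐚` with `P_𝐚(i,i) > 0`. -/
def ReturnDepths {G : Type*} [Fintype G] [DecidableEq G]
    (A : Set ℕ) (P : ℕ → G → G → ℝ) (i : G) : Set ℕ :=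
  {s | ∃ l : List ℕ, IsWord A l ∧ 0 < wordK P l i i ∧ l.sum = s}

/-- `E` is measurable with respect to the coordinates `(x_m)_{m < n}`. -/
def PastMeasurable {G : Type*} [MeasurableSpace G] (n : ℤ) (E : Set (ℤ → G)) : Prop :=
  MeasurableSet[MeasurableSpace.comap
    (fun x : ℤ → G => fun m : {m : ℤ // m < n} => x m.1) MeasurableSpace.pi] E

/-- `μ` is compatible with the imitation kernel
`p(g | w_{-1}, w_{-2}, …) = ∑_{k ∈ A} θ_k P_(k)(w_{-k}, g)` (here `θ` vanishes off `A`). -/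
def Compatible {G : Type*} [MeasurableSpace G] (θ : ℕ → ℝ) (P : ℕ → G → G → ℝ)
    (μ : Measure (ℤ → G)) : Prop :=
  ∀ (n : ℤ) (g : G) (E : Set (ℤ → G)), PastMeasurable n E →
    (μ (E ∩ {x | x n = g})).toReal
      = ∫ x in E, (∑' k : ℕ, θ k * P k (x (n - (k : ℤ))) g) ∂μ

/-- The weights `θ_k` and the matrices `P_(k)` define an imitation kernel that looks strictly into
the past. -/
structure IsImitationKernel {G : Type*} [Fintype G] (θ : ℕ → ℝ) (P : ℕ → G → G → ℝ) : Prop where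
  nonneg : ∀ k i j, 0 ≤ θ k * P k i j
  row_sum : ∀ k i, ∑ j, θ k * P k i j = θ k
  zero : θ 0 = 0
  hasSum : HasSum θ 1

/-- The conditional probability that the imitation kernel assigns to `x n = g` given the past. -/
noncomputable def nextProb {G : Type*} (θ : ℕ → ℝ) (P : ℕ → G → G → ℝ) (n : ℤ) (g : G)
    (x : ℤ → G) : ℝ :=
  ∑' k : ℕ, θ k * P k (x (n - (k : ℤ))) g

/-- The indicator function of `{x | x n = g}`. -/
def coordInd {G : Type*} [DecidableEq G] (n : ℤ) (g : G) (x : ℤ → G) : ℝ :=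
  if x n = g then 1 else 0

/-- Compatibility at the single time `n`, tested against continuous functions of the past. -/
def CompatibleAt {G : Type*} [DecidableEq G] [TopologicalSpace G] [MeasurableSpace G]
    (θ : ℕ → ℝ) (P : ℕ → G → G → ℝ) (n : ℤ) (μ : Measure (ℤ → G)) : Prop :=
  ∀ (g : G) (f : (ℤ → G) → ℝ), Continuous f → DependsOn f (Set.Iio n) →
    ∫ x, coordInd n g x * f x ∂μ = ∫ x, nextProb θ P n g x * f x ∂μ

/-- Every one-dimensional marginal of `μ` is `lam`. -/
def HasMarginals {G : Type*} [DecidableEq G] [MeasurableSpace G]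
    (lam : G → ℝ) (μ : Measure (ℤ → G)) : Prop :=
  ∀ (n : ℤ) (g : G), ∫ x, coordInd n g x ∂μ = lam g

/-- Resample the coordinate `n` according to the imitation kernel. -/
noncomputable def resample {G : Type*} [Fintype G] [MeasurableSpace G]
    (θ : ℕ → ℝ) (P : ℕ → G → G → ℝ) (n : ℤ) (μ : Measure (ℤ → G)) : Measure (ℤ → G) :=
  ∑ g, (μ.withDensity fun x => ENNReal.ofReal (nextProb θ P n g x)).map
    fun x => Function.update x n g

lemma Continuous.integrable_of_compactSpace {X : Type*} [TopologicalSpace X] [CompactSpace X]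
    [MeasurableSpace X] [OpensMeasurableSpace X] {μ : Measure X} [IsFiniteMeasure μ] {f : X → ℝ}
    (hf : Continuous f) : Integrable f μ :=
  hf.integrable_of_hasCompactSupport (HasCompactSupport.of_compactSpace f)

namespace IsImitationKernel

variable {G : Type*} [Fintype G] {θ : ℕ → ℝ} {P : ℕ → G → G → ℝ}

lemma le_weight (h : IsImitationKernel θ P) (k : ℕ) (i j : G) : θ k * P k i j ≤ θ k := by
  conv_rhs => rw [← h.row_sum k i]
  exact Finset.single_le_sum (f := fun j => θ k * P k i j) (fun j _ => h.nonneg k i j)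
    (Finset.mem_univ j)

lemma norm_le_weight (h : IsImitationKernel θ P) (k : ℕ) (i j : G) : ‖θ k * P k i j‖ ≤ θ k := by
  rw [Real.norm_of_nonneg (h.nonneg k i j)]
  exact h.le_weight k i j

lemma summable (h : IsImitationKernel θ P) (i : ℕ → G) (j : G) :
    Summable fun k => θ k * P k (i k) j :=
  h.hasSum.summable.of_norm_bounded fun k => h.norm_le_weight k (i k) j

lemma nextProb_nonneg (h : IsImitationKernel θ P) (n : ℤ) (g : G) (x : ℤ → G) :
    0 ≤ nextProb θ P n g x :=
  tsum_nonneg fun k => h.nonneg k _ g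

lemma sum_nextProb (h : IsImitationKernel θ P) (n : ℤ) (x : ℤ → G) :
    ∑ g, nextProb θ P n g x = 1 := by
  unfold nextProb
  rw [← Summable.tsum_finsetSum fun g _ => h.summable (fun k => x (n - (k : ℤ))) g]
  simp_rw [h.row_sum]
  exact h.hasSum.tsum_eq

lemma dependsOn_nextProb (h : IsImitationKernel θ P) (n : ℤ) (g : G) :
    DependsOn (nextProb θ P n g) (Set.Iio n) := by
  intro x y hxy
  refine tsum_congr fun k => ?_
  rcases Nat.eq_zero_or_pos k with rfl | hk
  · simp [h.zero]
  · rw [hxy (n - (k : ℤ)) (by simp only [Set.mem_Iio]; omega)]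

variable [TopologicalSpace G] [DiscreteTopology G]

lemma continuous_nextProb (h : IsImitationKernel θ P) (n : ℤ) (g : G) :
    Continuous (nextProb θ P n g) := by
  refine continuous_tsum (u := θ) (fun k => ?_) h.hasSum.summable
    fun k x => h.norm_le_weight k _ g
  exact (continuous_of_discreteTopology (f := fun i => θ k * P k i g)).comp (continuous_apply _)

lemma isFiniteMeasure_withDensity [MeasurableSpace G] [MeasurableSingletonClass G]
    {μ : Measure (ℤ → G)} [IsFiniteMeasure μ]
    (h : IsImitationKernel θ P) (n : ℤ) (g : G) :
    IsFiniteMeasure (μ.withDensity fun x => ENNReal.ofReal (nextProb θ P n g x)) :=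
  isFiniteMeasure_withDensity_ofReal (h.continuous_nextProb n g).integrable_of_compactSpace.2

end IsImitationKernel

lemma DependsOn.update_eq {ι α β : Type*} [DecidableEq ι] {f : (ι → α) → β} {s : Set ι}
    (hf : DependsOn f s) {i : ι} (hi : i ∉ s) (x : ι → α) (a : α) :
    f (Function.update x i a) = f x :=
  hf fun j hj => Function.update_of_ne (fun hji => hi (by rwa [← hji])) _ _

lemma DependsOn.fun_mul {ι α : Type*} {f g : (ι → α) → ℝ} {s : Set ι}
    (hf : DependsOn f s) (hg : DependsOn g s) : DependsOn (fun x => f x * g x) s :=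
  fun _ _ hxy => congrArg₂ (· * ·) (hf hxy) (hg hxy)

lemma Compatible.real_coord_eq {G : Type*} [MeasurableSpace G] {θ : ℕ → ℝ} {P : ℕ → G → G → ℝ}
    {μ : Measure (ℤ → G)} (hμ : Compatible θ P μ) (n : ℤ) (g : G) :
    μ.real {x | x n = g} = ∫ x, nextProb θ P n g x ∂μ := by
  simpa [nextProb, Measure.real] using hμ n g Set.univ MeasurableSet.univ

lemma measurableSet_coord_eq {G : Type*} [MeasurableSpace G] [MeasurableSingletonClass G]
    (n : ℤ) (g : G) :
    MeasurableSet {x : ℤ → G | x n = g} :=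
  measurable_pi_apply (X := fun _ : ℤ => G) n (t := {g}) (measurableSet_singleton g)

lemma Compatible.map_shift {G : Type*} [Fintype G] [TopologicalSpace G] [DiscreteTopology G]
    [MeasurableSpace G] [MeasurableSingletonClass G] {θ : ℕ → ℝ} {P : ℕ → G → G → ℝ}
    {μ : Measure (ℤ → G)} (h : IsImitationKernel θ P) (hμ : Compatible θ P μ) :
    Compatible θ P (μ.map fun x m => x (m + 1)) := by
  rintro n g E ⟨s, hs, rfl⟩
  have hT : Measurable fun (x : ℤ → G) (m : ℤ) => x (m + 1) :=
    measurable_pi_lambda _ fun m => measurable_pi_apply (m + 1)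
  have hπ : Measurable fun (x : ℤ → G) (m : {m : ℤ // m < n}) => x m.1 :=
    measurable_pi_lambda _ fun m => measurable_pi_apply m.1
  have hρ : Measurable fun (y : {m : ℤ // m < n + 1} → G) (m : {m : ℤ // m < n}) =>
      y ⟨m.1 + 1, by have := m.2; omega⟩ :=
    measurable_pi_lambda _ fun m => measurable_pi_apply _
  have hshift : ∀ x : ℤ → G,
      nextProb θ P n g (fun m => x (m + 1)) = nextProb θ P (n + 1) g x := fun x =>
    tsum_congr fun k => by simp only [show n - (k : ℤ) + 1 = n + 1 - k by ring]
  rw [Measure.map_apply hT ((hπ hs).inter (measurableSet_coord_eq n g))]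
  refine (hμ (n + 1) g _ ⟨_, hρ hs, rfl⟩).trans ?_
  refine Eq.trans ?_ (setIntegral_map (f := nextProb θ P n g) (hπ hs)
    (h.continuous_nextProb n g).aestronglyMeasurable hT.aemeasurable).symm
  simp_rw [hshift]
  rfl

section Coord

variable {G : Type*} [DecidableEq G]

lemma continuous_coordInd [TopologicalSpace G] [DiscreteTopology G] (n : ℤ) (g : G) :
    Continuous (coordInd n g) :=
  (continuous_of_discreteTopology (f := fun i : G => if i = g then (1 : ℝ) else 0)).comp
    (continuous_apply n)

lemma dependsOn_coordInd (n : ℤ) (g : G) : DependsOn (coordInd n g) {n} := by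
  intro x y hxy
  simp [coordInd, hxy n rfl]

lemma coordInd_eq_indicator (n : ℤ) (g : G) :
    coordInd n g = Set.indicator {x : ℤ → G | x n = g} 1 := by
  ext x
  simp [coordInd, Set.indicator_apply]

lemma integral_coordInd [MeasurableSpace G] [MeasurableSingletonClass G] (μ : Measure (ℤ → G))
    (n : ℤ) (g : G) : ∫ x, coordInd n g x ∂μ = μ.real {x | x n = g} := by
  rw [coordInd_eq_indicator, integral_indicator_one (measurableSet_coord_eq n g)]

lemma hasMarginals_of_map_shift_eq [MeasurableSpace G] [MeasurableSingletonClass G]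
    {μ : Measure (ℤ → G)} (hμ : (μ.map fun x m => x (m + 1)) = μ) :
    HasMarginals (fun g => μ.real {x | x 0 = g}) μ := by
  intro n g
  rw [integral_coordInd]
  have hT : Measurable fun (x : ℤ → G) (m : ℤ) => x (m + 1) :=
    measurable_pi_lambda _ fun m => measurable_pi_apply (m + 1)
  have hstep : ∀ m : ℤ, μ.real {x | x m = g} = μ.real {x | x (m + 1) = g} := fun m => by
    conv_lhs => rw [← hμ, map_measureReal_apply hT (measurableSet_coord_eq m g)]
    rfl
  induction n with
  | zero => rfl
  | succ i ih => rw [← hstep, ih]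
  | pred i ih => rw [hstep, sub_add_cancel, ih]

end Coord

section Integrals

variable {G : Type*} [Fintype G] [TopologicalSpace G] [DiscreteTopology G]
  [MeasurableSpace G] [MeasurableSingletonClass G] {θ : ℕ → ℝ} {P : ℕ → G → G → ℝ}
  {μ : Measure (ℤ → G)} {lam : G → ℝ} {n m : ℤ}

lemma isFiniteMeasure_resample [IsFiniteMeasure μ] (h : IsImitationKernel θ P) :
    IsFiniteMeasure (resample θ P n μ) := by
  have := h.isFiniteMeasure_withDensity (μ := μ) n
  unfold resample
  infer_instance

lemma integral_resample [IsFiniteMeasure μ] (h : IsImitationKernel θ P)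
    {f : (ℤ → G) → ℝ} (hf : Continuous f) :
    ∫ x, f x ∂(resample θ P n μ)
      = ∑ g, ∫ x, nextProb θ P n g x * f (Function.update x n g) ∂μ := by
  have := h.isFiniteMeasure_withDensity (μ := μ) n
  unfold resample
  rw [integral_finsetSum_measure fun g _ => hf.integrable_of_compactSpace]
  refine Finset.sum_congr rfl fun g _ => ?_
  have hupd : Continuous fun x : ℤ → G => Function.update x n g :=
    continuous_id.update n continuous_const
  rw [integral_map hupd.aemeasurable hf.aestronglyMeasurable,
    integral_withDensity_eq_integral_toReal_smul
      (h.continuous_nextProb n g).measurable.ennreal_ofReal (by simp)]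
  simp_rw [ENNReal.toReal_ofReal (h.nextProb_nonneg n g _), smul_eq_mul]

lemma integral_resample_of_dependsOn [IsFiniteMeasure μ] (h : IsImitationKernel θ P)
    {f : (ℤ → G) → ℝ} (hf : Continuous f) {s : Set ℤ} (hfs : DependsOn f s) (hn : n ∉ s) :
    ∫ x, f x ∂(resample θ P n μ) = ∫ x, f x ∂μ := by
  rw [integral_resample h hf]
  simp_rw [hfs.update_eq hn]
  rw [← integral_finsetSum]
  · simp_rw [← Finset.sum_mul, h.sum_nextProb, one_mul]
  · exact fun g _ => ((h.continuous_nextProb n g).mul hf).integrable_of_compactSpace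

lemma isProbabilityMeasure_resample [IsProbabilityMeasure μ] (h : IsImitationKernel θ P) :
    IsProbabilityMeasure (resample θ P n μ) := by
  have := isFiniteMeasure_resample (μ := μ) (n := n) h
  have h1 := integral_resample_of_dependsOn (μ := μ) (n := n) h
    (f := fun _ => 1) continuous_const (s := ∅) (fun _ _ _ => rfl) (by simp)
  simp only [integral_const, smul_eq_mul, mul_one, probReal_univ] at h1
  exact ⟨by rw [← ENNReal.toReal_eq_one_iff]; exact h1⟩

variable [DecidableEq G]

lemma integral_apply_coord [IsFiniteMeasure μ] (hm : HasMarginals lam μ) (c : G → ℝ) (n : ℤ) :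
    ∫ x, c (x n) ∂μ = ∑ i, lam i * c i := by
  have hc : ∀ x : ℤ → G, c (x n) = ∑ i, coordInd n i x * c i := fun x => by simp [coordInd]
  simp_rw [hc]
  rw [integral_finsetSum]
  · simp_rw [integral_mul_const, hm n]
  · exact fun i _ => ((continuous_coordInd n i).mul continuous_const).integrable_of_compactSpace

lemma integral_nextProb [IsProbabilityMeasure μ] (h : IsImitationKernel θ P)
    (hm : HasMarginals lam μ) (n : ℤ) (g : G) :
    ∫ x, nextProb θ P n g x ∂μ = ∑' k : ℕ, θ k * ∑ i, lam i * P k i g := by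
  have hterm : ∀ k : ℕ, Continuous fun x : ℤ → G => θ k * P k (x (n - (k : ℤ))) g := fun k =>
    (continuous_of_discreteTopology (f := fun i => θ k * P k i g)).comp (continuous_apply _)
  have hs : Summable fun k : ℕ => ∫ x : ℤ → G, ‖θ k * P k (x (n - (k : ℤ))) g‖ ∂μ := by
    refine h.hasSum.summable.of_nonneg_of_le
      (fun k => integral_nonneg fun x => norm_nonneg _) fun k => ?_
    calc ∫ x : ℤ → G, ‖θ k * P k (x (n - (k : ℤ))) g‖ ∂μ ≤ ∫ _ : ℤ → G, θ k ∂μ :=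
          integral_mono (hterm k).norm.integrable_of_compactSpace (integrable_const _)
            fun x => h.norm_le_weight k _ g
      _ = θ k := by simp
  unfold nextProb
  rw [← (hasSum_integral_of_summable_integral_norm
    (fun k => (hterm k).integrable_of_compactSpace) hs).tsum_eq]
  refine tsum_congr fun k => ?_
  rw [integral_const_mul, integral_apply_coord hm fun i => P k i g]

lemma compatibleAt_resample_self [IsFiniteMeasure μ] (h : IsImitationKernel θ P) :
    CompatibleAt θ P n (resample θ P n μ) := by
  intro g f hf hfn
  have hn : n ∉ Set.Iio n := by simp
  rw [integral_resample h (f := fun x => coordInd n g x * f x) ((continuous_coordInd n g).mul hf),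
    integral_resample_of_dependsOn h (f := fun x => nextProb θ P n g x * f x)
      ((h.continuous_nextProb n g).mul hf) 
      ((h.dependsOn_nextProb n g).fun_mul hfn) hn]
  simp_rw [hfn.update_eq hn]
  rw [Finset.sum_eq_single_of_mem g (Finset.mem_univ g) fun i _ hi => by simp [coordInd, hi]]
  simp [coordInd]

lemma CompatibleAt.resample [IsFiniteMeasure μ] (h : IsImitationKernel θ P)
    (hμ : CompatibleAt θ P m μ) (hmn : m < n) : CompatibleAt θ P m (resample θ P n μ) := by
  intro g f hf hfm
  have hn : n ∉ Set.Iic m := by simpa using hmn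
  rw [integral_resample_of_dependsOn h (f := fun x => coordInd m g x * f x)
      ((continuous_coordInd m g).mul hf)
      (((dependsOn_coordInd m g).mono (by simp)).fun_mul
        (hfm.mono Set.Iio_subset_Iic_self)) hn,
    integral_resample_of_dependsOn h (f := fun x => nextProb θ P m g x * f x)
      ((h.continuous_nextProb m g).mul hf)
      (((h.dependsOn_nextProb m g).fun_mul hfm).mono Set.Iio_subset_Iic_self) hn]
  exact hμ g f hf hfm

lemma HasMarginals.resample [IsProbabilityMeasure μ] (h : IsImitationKernel θ P)
    (hlam : ∀ g : G, ∑' k : ℕ, θ k * ∑ i, lam i * P k i g = lam g)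
    (hμ : HasMarginals lam μ) : HasMarginals lam (resample θ P n μ) := by
  intro m g
  rcases eq_or_ne n m with rfl | hnm
  · have hc := compatibleAt_resample_self (μ := μ) (n := n) h g (fun _ => 1) continuous_const
      fun _ _ _ => rfl
    simp only [mul_one] at hc
    rw [hc, integral_resample_of_dependsOn h (h.continuous_nextProb n g)
      (h.dependsOn_nextProb n g) (by simp), integral_nextProb h hμ, hlam]
  · rw [integral_resample_of_dependsOn h (continuous_coordInd m g) (dependsOn_coordInd m g)
      (by simpa using hnm), hμ]

lemma exists_hasMarginals (h0 : ∀ g : G, 0 ≤ lam g) (h1 : ∑ g, lam g = 1) :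
    ∃ μ : Measure (ℤ → G), IsProbabilityMeasure μ ∧ HasMarginals lam μ := by
  refine ⟨∑ g, ENNReal.ofReal (lam g) • Measure.dirac fun _ => g, ⟨?_⟩, fun n g => ?_⟩
  · simp [← ENNReal.ofReal_sum_of_nonneg fun g _ => h0 g, h1]
  · rw [integral_finsetSum_measure]
    · simp_rw [integral_smul_measure, integral_dirac, ENNReal.toReal_ofReal (h0 _)]
      simp [coordInd]
    · intro i _
      have : IsFiniteMeasure (ENNReal.ofReal (lam i) • Measure.dirac fun _ : ℤ => i) :=
        Measure.smul_finite _ ENNReal.ofReal_ne_top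
      exact (continuous_coordInd n g).integrable_of_compactSpace

lemma exists_compatibleAt_Ico (h : IsImitationKernel θ P)
    (h0 : ∀ g : G, 0 ≤ lam g) (h1 : ∑ g, lam g = 1)
    (hlam : ∀ g : G, ∑' k : ℕ, θ k * ∑ i, lam i * P k i g = lam g) (a : ℤ) (j : ℕ) :
    ∃ μ : Measure (ℤ → G), IsProbabilityMeasure μ ∧ HasMarginals lam μ ∧
      ∀ n ∈ Set.Ico a (a + j), CompatibleAt θ P n μ := by
  induction j with
  | zero =>
    obtain ⟨μ, hp, hm⟩ := exists_hasMarginals h0 h1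
    exact ⟨μ, hp, hm, fun n hn => by simp at hn⟩
  | succ j ih =>
    obtain ⟨μ, hp, hm, hc⟩ := ih
    refine ⟨resample θ P (a + j) μ, isProbabilityMeasure_resample h, hm.resample h hlam,
      fun n hn => ?_⟩
    simp only [Set.mem_Ico, Nat.cast_add, Nat.cast_one] at hn
    rcases (show n ≤ a + j by omega).eq_or_lt with rfl | hlt
    · exact compatibleAt_resample_self h
    · exact (hc n ⟨hn.1, hlt⟩).resample h hlt

lemma continuous_integral_probabilityMeasure {X : Type*} [TopologicalSpace X] [CompactSpace X]
    [MeasurableSpace X] [OpensMeasurableSpace X] {f : X → ℝ} (hf : Continuous f) :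
    Continuous fun μ : ProbabilityMeasure X => ∫ x, f x ∂(μ : Measure X) :=
  ProbabilityMeasure.continuous_integral_boundedContinuousFunction
    (BoundedContinuousFunction.mkOfCompact ⟨f, hf⟩)

lemma isClosed_hasMarginals (lam : G → ℝ) :
    IsClosed {μ : ProbabilityMeasure (ℤ → G) | HasMarginals lam (μ : Measure (ℤ → G))} := by
  simp only [HasMarginals, Set.ofPred_forall]
  exact isClosed_iInter fun n => isClosed_iInter fun g =>
    isClosed_eq (continuous_integral_probabilityMeasure (continuous_coordInd n g)) continuous_const

lemma isClosed_compatibleAt (h : IsImitationKernel θ P) (n : ℤ) :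
    IsClosed {μ : ProbabilityMeasure (ℤ → G) | CompatibleAt θ P n (μ : Measure (ℤ → G))} := by
  simp only [CompatibleAt, Set.ofPred_forall]
  exact isClosed_iInter fun g => isClosed_iInter fun f => isClosed_iInter fun hf =>
    isClosed_iInter fun _ => isClosed_eq
      (continuous_integral_probabilityMeasure ((continuous_coordInd n g).mul hf))
      (continuous_integral_probabilityMeasure ((h.continuous_nextProb n g).mul hf))

lemma exists_forall_compatibleAt (h : IsImitationKernel θ P)
    (h0 : ∀ g : G, 0 ≤ lam g) (h1 : ∑ g, lam g = 1)
    (hlam : ∀ g : G, ∑' k : ℕ, θ k * ∑ i, lam i * P k i g = lam g) :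
    ∃ μ : Measure (ℤ → G), IsProbabilityMeasure μ ∧ HasMarginals lam μ ∧
      ∀ n, CompatibleAt θ P n μ := by
  let t : ℕ → Set (ProbabilityMeasure (ℤ → G)) := fun N =>
    {μ | HasMarginals lam (μ : Measure (ℤ → G))} ∩
      ⋂ n ∈ Set.Ico (-N : ℤ) N, {μ | CompatibleAt θ P n (μ : Measure (ℤ → G))}
  have hclosed : ∀ N, IsClosed (t N) := fun N =>
    (isClosed_hasMarginals lam).inter
      (isClosed_biInter fun n _ => isClosed_compatibleAt h n)
  obtain ⟨μ, hμ⟩ := IsCompact.nonempty_iInter_of_sequence_nonempty_isCompact_isClosed t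
    (fun N => Set.inter_subset_inter_right _ (Set.biInter_subset_biInter_left fun n hn => by
      simp only [Set.mem_Ico, Nat.cast_add, Nat.cast_one] at hn ⊢
      omega))
    (fun N => by
      obtain ⟨μ, hp, hm, hc⟩ := exists_compatibleAt_Ico h h0 h1 hlam (-N) (2 * N)
      refine ⟨⟨μ, hp⟩, hm, Set.mem_iInter₂.2 fun n hn => hc n ?_⟩
      simp only [Set.mem_Ico, Nat.cast_mul, Nat.cast_ofNat] at hn ⊢
      omega)
    (hclosed 0).isCompact hclosed
  rw [Set.mem_iInter] at hμ
  refine ⟨μ, inferInstance, (hμ 0).1, fun n => ?_⟩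
  exact Set.mem_iInter₂.1 (hμ (n.natAbs + 1)).2 n (by simp only [Set.mem_Ico]; omega)

lemma compatible_of_forall_compatibleAt [IsProbabilityMeasure μ] (h : IsImitationKernel θ P)
    (hμ : ∀ n, CompatibleAt θ P n μ) : Compatible θ P μ := by
  rintro n g E ⟨s, hs, rfl⟩
  let π : (ℤ → G) → ({m : ℤ // m < n} → G) := fun x m => x m.1
  have hπ : Continuous π := continuous_pi fun m => continuous_apply m.1
  have hint : Integrable (nextProb θ P n g) μ :=
    (h.continuous_nextProb n g).integrable_of_compactSpace
  have := h.isFiniteMeasure_withDensity (μ := μ) n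
  have key : (μ.restrict {x | x n = g}).map π
      = (μ.withDensity fun x => ENNReal.ofReal (nextProb θ P n g x)).map π := by
    refine ext_of_forall_integral_eq_of_IsFiniteMeasure fun f => ?_
    rw [integral_map hπ.aemeasurable f.continuous.aestronglyMeasurable,
      integral_map hπ.aemeasurable f.continuous.aestronglyMeasurable,
      integral_withDensity_eq_integral_toReal_smul
        (h.continuous_nextProb n g).measurable.ennreal_ofReal (by simp),
      ← integral_indicator (measurableSet_coord_eq n g)]
    simp_rw [ENNReal.toReal_ofReal (h.nextProb_nonneg n g _), smul_eq_mul]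
    rw [← hμ n g (fun x => f (π x)) (f.continuous.comp hπ)
      fun x y hxy => congrArg f (funext fun m => hxy m.1 m.2)]
    exact integral_congr_ae (.of_forall fun x => by
      simp [coordInd, Set.indicator_apply])
  have hE := congrArg (fun ν => (ν s).toReal) key
  simp only [Measure.map_apply hπ.measurable hs,
    Measure.restrict_apply (hπ.measurable hs), withDensity_apply _ (hπ.measurable hs)] at hE
  rw [← integral_eq_lintegral_of_nonneg_ae (.of_forall (h.nextProb_nonneg n g))
    hint.integrableOn.1] at hE
  exact hE

lemma sum_real_coord [IsProbabilityMeasure μ] (n : ℤ) :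
    ∑ g, μ.real {x | x n = g} = 1 := by
  simp_rw [← integral_coordInd]
  rw [← integral_finsetSum _ fun g _ => (continuous_coordInd n g).integrable_of_compactSpace]
  simp [coordInd]

end Integrals

/-- if `𝒢(p)` has exactly one element, then `P̂ = ∑_k θ_k P_(k)`
has a unique invariant probability vector. -/
theorem stmt_11 {G : Type*} [Fintype G] [DecidableEq G] [Nonempty G]
    [MeasurableSpace G] [MeasurableSingletonClass G]
    (A : Set ℕ) (hA : A.Nonempty) (hApos : ∀ k ∈ A, 0 < k)
    (θ : ℕ → ℝ) (hθpos : ∀ k ∈ A, 0 < θ k) (hθ0 : ∀ k, k ∉ A → θ k = 0)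
    (hθsum : HasSum θ 1)
    (P : ℕ → G → G → ℝ)
    (hPnn : ∀ k ∈ A, ∀ i j : G, 0 ≤ P k i j)
    (hProw : ∀ k ∈ A, ∀ i : G, ∑ j, P k i j = 1)
    (huniq : ∃! μ : Measure (ℤ → G), IsProbabilityMeasure μ ∧ Compatible θ P μ) :
    ∃! lam : G → ℝ, (∀ g : G, 0 ≤ lam g) ∧ (∑ g, lam g = 1) ∧
      (∀ g : G, ∑' k : ℕ, θ k * ∑ i, lam i * P k i g = lam g) := by
  let _ : TopologicalSpace G := ⊥
  have : DiscreteTopology G := ⟨rfl⟩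
  have h : IsImitationKernel θ P :=
    { nonneg := fun k i j => by
        by_cases hk : k ∈ A
        · exact mul_nonneg (hθpos k hk).le (hPnn k hk i j)
        · simp [hθ0 k hk]
      row_sum := fun k i => by
        by_cases hk : k ∈ A
        · rw [← Finset.mul_sum, hProw k hk i, mul_one]
        · simp [hθ0 k hk]
      zero := hθ0 0 fun hk => (hApos 0 hk).ne rfl
      hasSum := hθsum }
  obtain ⟨μ, ⟨hp, hμ⟩, hu⟩ := huniq
  have hmarg : ∀ lam : G → ℝ, (∀ g, 0 ≤ lam g) → ∑ g, lam g = 1 →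
      (∀ g : G, ∑' k : ℕ, θ k * ∑ i, lam i * P k i g = lam g) → HasMarginals lam μ := by
    intro lam h0 h1 hlam
    obtain ⟨ν, hν, hm, hc⟩ := exists_forall_compatibleAt h h0 h1 hlam
    rwa [← hu ν ⟨hν, compatible_of_forall_compatibleAt h hc⟩]
  have hT : Measurable fun (x : ℤ → G) (m : ℤ) => x (m + 1) :=
    measurable_pi_lambda _ fun m => measurable_pi_apply (m + 1)
  have hm := hasMarginals_of_map_shift_eq
    (hu _ ⟨Measure.isProbabilityMeasure_map hT.aemeasurable, hμ.map_shift h⟩)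
  refine ⟨fun g => μ.real {x | x 0 = g},
    ⟨fun g => measureReal_nonneg, sum_real_coord 0, fun g => ?_⟩, fun lam hlam => ?_⟩
  · exact (integral_nextProb h hm 0 g).symm.trans (hμ.real_coord_eq 0 g).symm
  · ext g
    rw [← hmarg lam hlam.1 hlam.2.1 hlam.2.2 0 g, integral_coordInd]
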